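/- Let T_R be a good n-tilting module with endomorphism ring S. Then the canonical ring homomorphism R → End_S(_S T) sending r to right multiplication by r is an isomorphism, i.e. T is a faithfully balanced bimodule on the R side: R ≅ End(_S T). -/

import Mathlib

open CategoryTheory CategoryTheory.Limits

/-- the `n`-th Ext group `Ext^n_A(M,N)` (as a `ℤ`-module). -/
noncomputable def extRT (A : Type) [Ring A] (n : ℕ) (M N : ModuleCat A) : ModuleCat ℤ :=
  ((Ext ℤ (ModuleCat A) n).obj (Opposite.op M)).obj N
section Tilting

variable (R : Type) [Ring R]

/-- `X` is a direct summand of a direct sum of copies of `T`. -/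
def IsSummandOfCopies (T X : Type) [AddCommGroup T] [Module R T]
    [AddCommGroup X] [Module R X] : Prop :=
  ∃ (α : Type) (s : X →ₗ[R] (α →₀ T)) (r : (α →₀ T) →ₗ[R] X), r ∘ₗ s = LinearMap.id

/-- `X` is a direct summand of a finite direct sum of copies of `T`. -/
def IsSummandOfFinCopies (T X : Type) [AddCommGroup T] [Module R T]
    [AddCommGroup X] [Module R X] : Prop :=
  ∃ (k : ℕ) (s : X →ₗ[R] (Fin k → T)) (r : (Fin k → T) →ₗ[R] X), r ∘ₗ s = LinearMap.id

/-- `T` is an `n`-tilting module: (T1) it admits a projective resolution of length `n`,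
(T2) `Ext^i_R(T, T^{(α)}) = 0` for `i > 0` and all cardinals `α`, and (T3) there is an
exact coresolution `0 → R → T_0 → ⋯ → T_m → 0` with each `T_i ∈ Add(T)`. -/
structure IsNTilting (n : ℕ) (T : ModuleCat R) : Prop where
  t1 : ∃ P : ProjectiveResolution T, ∀ i, n < i → IsZero (P.complex.X i)
  t2 : ∀ i : ℕ, 0 < i → ∀ α : Type,
      Subsingleton (extRT R i T (ModuleCat.of R (α →₀ T)))
  t3 : ∃ (m : ℕ) (Tc : ℕ → ModuleCat R) (g : ∀ i, Tc i ⟶ Tc (i + 1))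
      (ι : R →ₗ[R] Tc 0),
      Function.Injective ι ∧ Function.Exact ι (g 0) ∧
      (∀ i, Function.Exact (g i) (g (i + 1))) ∧
      (∀ i, i ≤ m → IsSummandOfCopies R T (Tc i)) ∧
      (∀ i, m < i → Subsingleton (Tc i))

/-- `T` is a good `n`-tilting module: (T1), (T2) and (T3'): there is an exact
coresolution `0 → R → T_0 → ⋯ → T_n → 0` whose terms are direct summands of finite
direct sums of copies of `T`. -/
structure IsGoodNTilting (n : ℕ) (T : ModuleCat R) : Prop where
  t1 : ∃ P : ProjectiveResolution T, ∀ i, n < i → IsZero (P.complex.X i)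
  t2 : ∀ i : ℕ, 0 < i → ∀ α : Type,
      Subsingleton (extRT R i T (ModuleCat.of R (α →₀ T)))
  t3' : ∃ (Tc : ℕ → ModuleCat R) (g : ∀ i, Tc i ⟶ Tc (i + 1))
      (ι : R →ₗ[R] Tc 0),
      Function.Injective ι ∧ Function.Exact ι (g 0) ∧
      (∀ i, Function.Exact (g i) (g (i + 1))) ∧
      (∀ i, i ≤ n → IsSummandOfFinCopies R T (Tc i)) ∧
      (∀ i, n < i → Subsingleton (Tc i))

end Tilting

/-- Vanishing of the left-derived `Ext` implies vanishing of the derived-category `Ext`. -/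
theorem subsingleton_abelianExt_of_extRT {A : Type} [Ring A] {M N : ModuleCat A} {i : ℕ}
    (hi : 0 < i) (h : Subsingleton (extRT A i M N)) : Subsingleton (Abelian.Ext M N i) := by
  let P := ProjectiveResolution.of M
  obtain ⟨p, rfl⟩ : ∃ p, i = p + 1 := ⟨i - 1, by omega⟩
  have hz : IsZero (extRT A (p + 1) M N) := ModuleCat.isZero_of_subsingleton _
  have hz' : IsZero ((P.complex.linearYonedaObj ℤ N).homology (p + 1)) :=
    hz.of_iso (P.isoExt (p + 1) N).symm
  rw [← HomologicalComplex.exactAt_iff_isZero_homology,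
    HomologicalComplex.exactAt_iff' _ p (p + 1) (p + 2) (by simp) (by simp),
    ShortComplex.moduleCat_exact_iff] at hz'
  refine subsingleton_of_forall_eq 0 fun x => ?_
  obtain ⟨f, hf, rfl⟩ := P.extMk_surjective x (p + 2) rfl
  rw [P.extMk_eq_zero_iff f (p + 2) rfl hf p rfl]
  exact hz' f hf

/-- A summand of a finite direct sum of copies of `T` inherits the vanishing of
`Ext` from `T`. -/
theorem IsSummandOfFinCopies.subsingleton_ext {R : Type} [Ring R] {T X : ModuleCat R}
    (hX : IsSummandOfFinCopies R T X) {Y : ModuleCat R} {i : ℕ}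
    (h : Subsingleton (Abelian.Ext T Y i)) : Subsingleton (Abelian.Ext X Y i) := by
  obtain ⟨k, s, r, hrs⟩ := hX
  have hid : 𝟙 X = ∑ j : Fin k, (ModuleCat.ofHom (LinearMap.proj j ∘ₗ s) : X ⟶ T) ≫
      ModuleCat.ofHom (r ∘ₗ LinearMap.single R (fun _ => (T : Type)) j) := by
    ext x
    have hx : r (s x) = x := LinearMap.congr_fun hrs x
    simp only [ModuleCat.hom_sum, LinearMap.sum_apply]
    conv_lhs => rw [ModuleCat.id_apply, ← hx, ← Finset.univ_sum_single (s x), map_sum]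
    rfl
  refine subsingleton_of_forall_eq 0 fun x => ?_
  rw [← Abelian.Ext.mk₀_id_comp x, hid, Abelian.Ext.mk₀_sum, Abelian.Ext.sum_comp]
  refine Finset.sum_eq_zero fun j _ => ?_
  rw [← Abelian.Ext.mk₀_comp_mk₀_assoc, Subsingleton.elim ((Abelian.Ext.mk₀ _).comp x _) 0,
    Abelian.Ext.comp_zero]

/-- A good tilting module has no self-extensions. -/
theorem IsGoodNTilting.subsingleton_ext_self {R : Type} [Ring R] {n : ℕ} {T : ModuleCat R}
    (hT : IsGoodNTilting R n T) {i : ℕ} (hi : 0 < i) : Subsingleton (Abelian.Ext T T i) := by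
  have h := subsingleton_abelianExt_of_extRT hi (hT.t2 i hi Unit)
  let e : ModuleCat.of R (Unit →₀ T) ≅ T :=
    (Finsupp.uniqueLinearEquiv R T ()).toModuleIso
  refine subsingleton_of_forall_eq 0 fun x => ?_
  rw [← Abelian.Ext.comp_mk₀_id x, ← e.inv_hom_id, ← Abelian.Ext.mk₀_comp_mk₀,
    ← Abelian.Ext.comp_assoc_of_third_deg_zero,
    Subsingleton.elim (x.comp (Abelian.Ext.mk₀ e.inv) _) 0, Abelian.Ext.zero_comp]

/-- A pair of composable linear maps, injective, exact and surjective, is a short exact sequence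
of modules. -/
theorem ModuleCat.shortExact_of_linearMap {R : Type} [Ring R] {A B C : Type} [AddCommGroup A]
    [Module R A] [AddCommGroup B] [Module R B] [AddCommGroup C] [Module R C]
    (f : A →ₗ[R] B) (g : B →ₗ[R] C) (hf : Function.Injective f) (hfg : Function.Exact f g)
    (hg : Function.Surjective g) :
    (ShortComplex.mk (ModuleCat.ofHom f) (ModuleCat.ofHom g) (by
      ext x; exact hfg.apply_apply_eq_zero x)).ShortExact := by
  have : Mono (ModuleCat.ofHom f) := (ModuleCat.mono_iff_injective _).2 hf
  have : Epi (ModuleCat.ofHom g) := (ModuleCat.epi_iff_surjective _).2 hg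
  exact { exact := (ShortComplex.ShortExact.moduleCat_exact_iff_function_exact _).2 hfg }

/-- The corestriction of `f` to the kernel of `g` is surjective when `f`, `g` are exact. -/
theorem Function.Exact.codRestrict_ker_surjective {R : Type} [Ring R] {A B C : Type}
    [AddCommGroup A] [Module R A] [AddCommGroup B] [Module R B] [AddCommGroup C] [Module R C]
    {f : A →ₗ[R] B} {g : B →ₗ[R] C} (hfg : Function.Exact f g) :
    Function.Surjective (f.codRestrict (LinearMap.ker g) hfg.apply_apply_eq_zero) := by
  rintro ⟨y, hy⟩
  obtain ⟨x, rfl⟩ := (hfg y).1 hy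
  exact ⟨x, rfl⟩

/-- Dimension shifting: in an eventually zero exact sequence of modules without higher extensions
by `Y`, the kernels have no higher extensions by `Y` either. -/
theorem subsingleton_ext_ker_of_exact {R : Type} [Ring R] {n : ℕ} {X : ℕ → ModuleCat R}
    {g : ∀ i, X i ⟶ X (i + 1)} {Y : ModuleCat R}
    (hg : ∀ i, Function.Exact (g i) (g (i + 1)))
    (hext : ∀ i j, 0 < j → Subsingleton (Abelian.Ext (X i) Y j))
    (hzero : ∀ i, n < i → Subsingleton (X i)) (i j : ℕ) (hj : 0 < j) :
    Subsingleton (Abelian.Ext (ModuleCat.of R (LinearMap.ker (g i).hom)) Y j) := by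
  obtain hi | hi := lt_or_ge n i
  · have := hzero i hi
    have hz : IsZero (ModuleCat.of R (LinearMap.ker (g i).hom)) :=
      ModuleCat.isZero_of_subsingleton _
    refine subsingleton_of_forall_eq 0 fun x => ?_
    rw [← Abelian.Ext.mk₀_id_comp x, hz.eq_of_src (𝟙 _) 0, Abelian.Ext.mk₀_zero,
      Abelian.Ext.zero_comp]
  · have hS := ModuleCat.shortExact_of_linearMap (LinearMap.ker (g i).hom).subtype
      ((g i).hom.codRestrict (LinearMap.ker (g (i + 1)).hom) (hg i).apply_apply_eq_zero)
      (Submodule.subtype_injective _)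
      (fun x => by
        rw [Subtype.ext_iff, Submodule.coe_subtype, Subtype.range_coe]
        exact Iff.rfl)
      (Function.Exact.codRestrict_ker_surjective (hg i))
    have := subsingleton_ext_ker_of_exact hg hext hzero (i + 1) (1 + j) (by omega)
    have := hext i j hj
    refine subsingleton_of_forall_eq 0 fun x => ?_
    obtain ⟨y, rfl⟩ := Abelian.Ext.contravariant_sequence_exact₁ hS Y x rfl
      (Subsingleton.elim (α := Abelian.Ext (ModuleCat.of R (LinearMap.ker (g (i + 1)).hom)) Y _)
        _ _)
    have hy : y = 0 := Subsingleton.elim (α := Abelian.Ext (X i) Y j) _ _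
    rw [hy, Abelian.Ext.comp_zero]
termination_by n + 1 - i

/-- If the cokernel of an injective map has no extensions by `Y`, then maps to `Y` extend along
it. -/
theorem CategoryTheory.ShortComplex.ShortExact.exists_extension {R : Type} [Ring R]
    {S : ShortComplex (ModuleCat R)} (hS : S.ShortExact) {Y : ModuleCat R}
    (h : Subsingleton (Abelian.Ext S.X₃ Y 1)) (f : S.X₁ ⟶ Y) : ∃ F : S.X₂ ⟶ Y, S.f ≫ F = f := by
  obtain ⟨y, hy⟩ := Abelian.Ext.contravariant_sequence_exact₁ hS Y (Abelian.Ext.mk₀ f)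
    (n₁ := 1) rfl (Subsingleton.elim _ _)
  obtain ⟨F, rfl⟩ := (Abelian.Ext.mk₀_bijective _ _).2 y
  rw [Abelian.Ext.mk₀_comp_mk₀] at hy
  exact ⟨F, (Abelian.Ext.mk₀_bijective _ _).1 hy⟩

/-- An `End_R(T)`-linear endomorphism `h` of `T` transports to every summand `X` of a finite power
of `T`: each `x` has an image `x'` compatible with all linear maps `X → T`. -/
theorem IsSummandOfFinCopies.exists_transport {R : Type} [Ring R] {T X : Type} [AddCommGroup T]
    [Module R T] [AddCommGroup X] [Module R X] (hX : IsSummandOfFinCopies R T X)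
    (h : Module.End (Module.End R T) T) (x : X) : ∃ x' : X, ∀ φ : X →ₗ[R] T, φ x' = h (φ x) := by
  obtain ⟨k, s, r, hrs⟩ := hX
  refine ⟨r fun j => h (s x j), fun φ => ?_⟩
  have key : ∀ y : Fin k → T,
      φ (r y) = ∑ j, (φ ∘ₗ r ∘ₗ LinearMap.single R (fun _ => T) j : Module.End R T) • y j := by
    intro y
    conv_lhs => rw [← Finset.univ_sum_single y, map_sum, map_sum]
    rfl
  have hx : r (s x) = x := LinearMap.congr_fun hrs x
  rw [key]
  conv_rhs => rw [← hx, key, map_sum]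
  simp only [map_smul]

/-- Maps to `T` separate the points of a summand of a finite power of `T`. -/
theorem IsSummandOfFinCopies.eq_zero_of_forall {R : Type} [Ring R] {T X : Type} [AddCommGroup T]
    [Module R T] [AddCommGroup X] [Module R X] (hX : IsSummandOfFinCopies R T X) {x : X}
    (h : ∀ φ : X →ₗ[R] T, φ x = 0) : x = 0 := by
  obtain ⟨k, s, r, hrs⟩ := hX
  have hs : s x = 0 := funext fun j => h (LinearMap.proj j ∘ₗ s)
  rw [← LinearMap.id_apply (R := R) x, ← hrs, LinearMap.comp_apply, hs, map_zero]

/-- If `T` is a good `n`-tilting module with `S = End_R(T)`, then the canonical ring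
homomorphism `R → End_S(T)` is bijective: `T` is faithfully balanced on the `R` side. -/
theorem statement11 (R : Type) [Ring R] (n : ℕ) (T : Type) [AddCommGroup T] [Module R T]
    (hT : IsGoodNTilting R n (ModuleCat.of R T)) :
    Function.Bijective (Module.toModuleEnd (Module.End R T) T : R →+* _) := by
  obtain ⟨Tc, g, ι, hι, hιg, hg, hsummand, hzero⟩ := hT.t3'
  have hfin : ∀ i, IsSummandOfFinCopies R T (Tc i) := fun i => by
    obtain hi | hi := lt_or_ge n i
    · have := hzero i hi
      exact ⟨0, 0, 0, LinearMap.ext fun _ => Subsingleton.elim _ _⟩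
    · exact hsummand i hi
  have hker := subsingleton_ext_ker_of_exact hg (Y := ModuleCat.of R T)
    (fun i j hj => (hfin i).subsingleton_ext (T := ModuleCat.of R T) (hT.subsingleton_ext_self hj))
    hzero
  constructor
  · rw [injective_iff_map_eq_zero]
    intro a ha
    apply hι
    rw [map_zero]
    refine (hfin 0).eq_zero_of_forall fun φ => ?_
    rw [← mul_one a, ← smul_eq_mul, map_smul, map_smul]
    exact LinearMap.congr_fun ha _
  · intro h
    obtain ⟨x, hx⟩ := (hfin 0).exists_transport h (ι 1)
    have hgx : g 0 x = 0 := (hfin 1).eq_zero_of_forall fun φ => by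
      have := hx (φ ∘ₗ (g 0).hom)
      rwa [LinearMap.comp_apply, LinearMap.comp_apply, hιg.apply_apply_eq_zero, map_zero,
        map_zero] at this
    obtain ⟨a, rfl⟩ := (hιg x).1 hgx
    refine ⟨a, LinearMap.ext fun t => ?_⟩
    have hS := ModuleCat.shortExact_of_linearMap ι
      ((g 0).hom.codRestrict (LinearMap.ker (g 1).hom) (hg 0).apply_apply_eq_zero) hι
      (fun y => by
        rw [Subtype.ext_iff]
        exact hιg y)
      (Function.Exact.codRestrict_ker_surjective (hg 0))
    obtain ⟨F, hF⟩ := hS.exists_extension (Y := ModuleCat.of R T) (hker 1 1 one_pos)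
      (ModuleCat.ofHom (LinearMap.toSpanSingleton R T t))
    have hF' : ∀ b : R, F.hom (ι b) = b • t := fun b => LinearMap.congr_fun
      (congrArg ModuleCat.Hom.hom hF) b
    have := hx F.hom
    rw [hF', hF', one_smul] at this
    exact this
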